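/- Let R be a commutative ring with elements h_1, h_2, h_3, … ∈ R and let n be a positive integer. Then the sum of Ψ(a) over all compositions a of n equals h_1^n, i.e. Σ_{a ∈ C(n)} Ψ(a) = h_1^n, where C(n) denotes the set of all compositions of n. -/

import Mathlib

/-- A composition of `n`: a list of positive integers summing to `n`. -/
def IsComposition (n : ℕ) (a : List ℕ) : Prop :=
  (∀ x ∈ a, 0 < x) ∧ a.sum = n

/-- `b` is a coarsening of `a`: `b` is obtained by summing consecutive nonempty blocks of `a`. -/
def Coarsen (a b : List ℕ) : Prop :=
  ∃ L : List (List ℕ), (∀ l ∈ L, l ≠ []) ∧ L.flatten = a ∧ b = L.map List.sum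

/-- `Ψ(a) = Σ_{a ⪯ b} (−1)^{l(b)−l(a)} h_{b_1} ⋯ h_{b_{l(b)}}`, summed over all
coarsenings `b` of `a` (a finite set).  Since `l(b) ≤ l(a)`, the sign
`(−1)^{l(b)−l(a)}` equals `(−1)^{l(a)−l(b)}`. -/
noncomputable def Psi {R : Type*} [CommRing R] (h : ℕ → R) (a : List ℕ) : R :=
  ∑ᶠ b ∈ {b : List ℕ | Coarsen a b},
    (-1 : R) ^ (a.length - b.length) * (b.map h).prod

theorem coarsen_singleton_iff (x : ℕ) (b : List ℕ) : Coarsen [x] b ↔ b = [x] := by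
  constructor
  · rintro ⟨L, hL, hflat, rfl⟩
    match L, hL, hflat with
    | [] :: _, hL, _ => simp at hL
    | (z :: l) :: L', hL, hflat =>
      simp only [List.flatten_cons, List.cons_append, List.cons.injEq,
        List.append_eq_nil_iff, List.flatten_eq_nil_iff] at hflat
      obtain ⟨rfl, rfl, hL'⟩ := hflat
      have : L' = [] := List.eq_nil_iff_forall_not_mem.2 fun m hm =>
        hL m (List.mem_cons_of_mem _ hm) (hL' m hm)
      simp [this]
  · rintro rfl
    exact ⟨[[x]], by simp, by simp, by simp⟩

/-- A coarsening of `x :: y :: t` either keeps `x` as a part of its own or merges it with `y`. -/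
theorem coarsen_cons_cons_iff (x y : ℕ) (t b : List ℕ) :
    Coarsen (x :: y :: t) b ↔
      (∃ b', Coarsen (y :: t) b' ∧ x :: b' = b) ∨ Coarsen ((x + y) :: t) b := by
  constructor
  · rintro ⟨L, hL, hflat, rfl⟩
    match L, hL, hflat with
    | [] :: _, hL, _ => simp at hL
    | [z] :: L', hL, hflat =>
      simp only [List.flatten_cons, List.cons_append, List.nil_append, List.cons.injEq] at hflat
      obtain ⟨rfl, hflat'⟩ := hflat
      exact .inl ⟨_, ⟨L', fun l hl => hL l (List.mem_cons_of_mem _ hl), hflat', rfl⟩, by simp⟩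
    | (z :: w :: l) :: L', hL, hflat =>
      simp only [List.flatten_cons, List.cons_append, List.cons.injEq] at hflat
      obtain ⟨rfl, rfl, rfl⟩ := hflat
      refine .inr ⟨((z + w) :: l) :: L', ?_, by simp, by simp [add_assoc]⟩
      intro m hm
      rcases List.mem_cons.1 hm with rfl | hm
      · simp
      · exact hL m (List.mem_cons_of_mem _ hm)
  · rintro (⟨_, ⟨L, hL, hflat, rfl⟩, rfl⟩ | ⟨L, hL, hflat, rfl⟩)
    · exact ⟨[x] :: L, by simpa using hL, by simp [hflat], by simp⟩
    · match L, hL, hflat with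
      | [] :: _, hL, _ => simp at hL
      | (z :: l) :: L', hL, hflat =>
        simp only [List.flatten_cons, List.cons_append, List.cons.injEq] at hflat
        obtain ⟨rfl, rfl⟩ := hflat
        refine ⟨(x :: y :: l) :: L', ?_, by simp, by simp [add_assoc]⟩
        intro m hm
        rcases List.mem_cons.1 hm with rfl | hm
        · simp
        · exact hL m (List.mem_cons_of_mem _ hm)

theorem setOf_coarsen_cons_cons (x y : ℕ) (t : List ℕ) :
    {b | Coarsen (x :: y :: t) b} =
      List.cons x '' {b | Coarsen (y :: t) b} ∪ {b | Coarsen ((x + y) :: t) b} := by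
  ext b
  exact coarsen_cons_cons_iff x y t b

theorem finite_setOf_coarsen_cons (x : ℕ) (t : List ℕ) : {b | Coarsen (x :: t) b}.Finite := by
  induction t generalizing x with
  | nil => simp [coarsen_singleton_iff]
  | cons y t ih =>
    rw [setOf_coarsen_cons_cons]
    exact ((ih y).image _).union (ih (x + y))

theorem Coarsen.length_le {a b : List ℕ} (hab : Coarsen a b) : b.length ≤ a.length := by
  obtain ⟨L, hL, rfl, rfl⟩ := hab
  rw [List.length_map, List.length_flatten]
  simpa using List.length_le_sum_of_one_le (L.map List.length) (by
    intro k hk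
    obtain ⟨l, hl, rfl⟩ := List.mem_map.1 hk
    exact List.length_pos_iff.2 (hL l hl))

theorem Coarsen.exists_cons_of_cons {x : ℕ} {t b : List ℕ} (hb : Coarsen (x :: t) b) :
    ∃ z b', b = z :: b' ∧ x ≤ z := by
  obtain ⟨L, hL, hflat, rfl⟩ := hb
  match L, hL, hflat with
  | [] :: _, hL, _ => simp at hL
  | (z :: l) :: L', hL, hflat =>
    simp only [List.flatten_cons, List.cons_append, List.cons.injEq] at hflat
    obtain ⟨rfl, rfl⟩ := hflat
    exact ⟨_, _, rfl, by simp⟩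

theorem Psi_singleton {R : Type*} [CommRing R] (h : ℕ → R) (x : ℕ) : Psi h [x] = h x := by
  simp [Psi, coarsen_singleton_iff]

theorem Psi_cons_cons {R : Type*} [CommRing R] (h : ℕ → R) (x : ℕ) {y : ℕ} (hy : 0 < y)
    (t : List ℕ) :
    Psi h (x :: y :: t) = h x * Psi h (y :: t) - Psi h ((x + y) :: t) := by
  have hdisj : Disjoint (List.cons x '' {b | Coarsen (y :: t) b})
      {b | Coarsen ((x + y) :: t) b} := by
    rw [Set.disjoint_left]
    rintro _ ⟨b, -, rfl⟩ hb
    obtain ⟨z, b', hzb, hz⟩ := Coarsen.exists_cons_of_cons hb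
    obtain ⟨rfl, -⟩ := List.cons.inj hzb
    omega
  have hfin := finite_setOf_coarsen_cons y t
  have hfin' := finite_setOf_coarsen_cons (x + y) t
  unfold Psi
  rw [setOf_coarsen_cons_cons, finsum_mem_union hdisj (hfin.image _) hfin',
    finsum_mem_image List.cons_injective.injOn, sub_eq_add_neg, mul_finsum_mem' _ _ hfin,
    ← finsum_mem_neg_distrib _ hfin']
  congr 1
  · refine finsum_mem_congr rfl fun b _ => ?_
    simp only [List.length_cons, List.map_cons, List.prod_cons, Nat.add_sub_add_right]
    ring
  · refine finsum_mem_congr rfl fun b hb => ?_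
    have hle := Coarsen.length_le hb
    simp only [List.length_cons] at hle ⊢
    rw [Nat.sub_add_comm hle, pow_succ]
    ring

theorem setOf_isComposition_one : {a | IsComposition 1 a} = {[1]} := by
  ext a
  simp only [Set.mem_ofPred_eq, Set.mem_singleton_iff]
  constructor
  · rintro ⟨hpos, hsum⟩
    match a, hpos, hsum with
    | [x], _, hsum => simpa using hsum
    | x :: y :: t, hpos, hsum =>
      have hx := hpos x (by simp)
      have hy := hpos y (by simp)
      simp only [List.sum_cons] at hsum
      omega
  · rintro rfl
    simp [IsComposition]

/-- A composition of `n + 2` arises from one of `n + 1` by prepending a part `1` or by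
incrementing the first part. -/
theorem setOf_isComposition_add_two (n : ℕ) :
    {a | IsComposition (n + 2) a} =
      List.cons 1 '' {a | IsComposition (n + 1) a} ∪
        List.modifyHead (1 + ·) '' {a | IsComposition (n + 1) a} := by
  ext a
  simp only [Set.mem_ofPred_eq, Set.mem_union, Set.mem_image]
  constructor
  · rintro ⟨hpos, hsum⟩
    match a, hpos, hsum with
    | 0 :: t, hpos, _ => simp at hpos
    | 1 :: t, hpos, hsum =>
      refine .inl ⟨t, ⟨fun x hx => hpos x (List.mem_cons_of_mem _ hx), ?_⟩, rfl⟩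
      simp only [List.sum_cons] at hsum
      omega
    | (x + 2) :: t, hpos, hsum =>
      refine .inr ⟨(x + 1) :: t, ⟨?_, ?_⟩, by simp; omega⟩
      · intro z hz
        rcases List.mem_cons.1 hz with rfl | hz
        · omega
        · exact hpos z (List.mem_cons_of_mem _ hz)
      · simp only [List.sum_cons] at hsum ⊢
        omega
  · rintro (⟨t, ⟨hpos, hsum⟩, rfl⟩ | ⟨t, ⟨hpos, hsum⟩, rfl⟩)
    · refine ⟨?_, by simp only [List.sum_cons]; omega⟩
      simpa using hpos
    · match t, hpos, hsum with
      | x :: t, hpos, hsum =>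
        refine ⟨?_, ?_⟩
        · intro z hz
          rcases List.mem_cons.1 hz with rfl | hz
          · exact Nat.add_pos_left one_pos x
          · exact hpos z (List.mem_cons_of_mem _ hz)
        · simp only [List.modifyHead_cons, List.sum_cons] at hsum ⊢
          omega

theorem finite_setOf_isComposition_succ (n : ℕ) : {a | IsComposition (n + 1) a}.Finite := by
  induction n with
  | zero => simp [setOf_isComposition_one]
  | succ n ih =>
    rw [setOf_isComposition_add_two]
    exact (ih.image _).union (ih.image _)

theorem modifyHead_one_add_injective : Function.Injective (List.modifyHead (1 + · : ℕ → ℕ)) := by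
  rintro (_ | ⟨x, s⟩) (_ | ⟨y, t⟩) hst <;> simp_all

theorem IsComposition.exists_cons {n : ℕ} {a : List ℕ} (ha : IsComposition (n + 1) a) :
    ∃ x t, a = x :: t ∧ 0 < x := by
  obtain ⟨hpos, hsum⟩ := ha
  cases a with
  | nil => simp at hsum
  | cons x t => exact ⟨x, t, rfl, hpos x (by simp)⟩

theorem Psi_sum_add_two {R : Type*} [CommRing R] (h : ℕ → R) (n : ℕ) :
    ∑ᶠ a ∈ {a : List ℕ | IsComposition (n + 2) a}, Psi h a =
      h 1 * ∑ᶠ a ∈ {a : List ℕ | IsComposition (n + 1) a}, Psi h a := by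
  have hfin := finite_setOf_isComposition_succ n
  have hdisj : Disjoint (List.cons 1 '' {a | IsComposition (n + 1) a})
      (List.modifyHead (1 + ·) '' {a | IsComposition (n + 1) a}) := by
    rw [Set.disjoint_left]
    rintro _ ⟨s, -, rfl⟩ ⟨a, ha, has⟩
    obtain ⟨x, t, rfl, hx⟩ := IsComposition.exists_cons ha
    simp only [List.modifyHead_cons, List.cons.injEq] at has
    omega
  rw [setOf_isComposition_add_two, finsum_mem_union hdisj (hfin.image _) (hfin.image _),
    finsum_mem_image List.cons_injective.injOn,
    finsum_mem_image modifyHead_one_add_injective.injOn, ← finsum_mem_add_distrib hfin,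
    mul_finsum_mem' _ _ hfin]
  refine finsum_mem_congr rfl fun a ha => ?_
  obtain ⟨x, t, rfl, hx⟩ := IsComposition.exists_cons ha
  rw [Psi_cons_cons h 1 hx, List.modifyHead_cons, sub_add_cancel]

/-- The sum of `Ψ(a)` over all compositions `a` of `n ≥ 1` equals `h_1 ^ n`. -/
theorem Psi_sum_eq_pow {R : Type*} [CommRing R] (h : ℕ → R) (n : ℕ) (hn : 0 < n) :
    ∑ᶠ a ∈ {a : List ℕ | IsComposition n a}, Psi h a = (h 1) ^ n := by
  obtain ⟨n, rfl⟩ := Nat.exists_eq_succ_of_ne_zero hn.ne'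
  induction n with
  | zero => simp [setOf_isComposition_one, Psi_singleton]
  | succ n ih => rw [Psi_sum_add_two, ih n.succ_pos, ← pow_succ']
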